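/- Let $W_1,\ldots,W_n$ be i.i.d. $\mathsf{N}(0,1+\tau^2)$ random variables (with $\tau>0$), constructed as $W_i = \tau\varepsilon_i + e_i$ where $\varepsilon_i, e_i$ are independent standard normals. Let $W_b = \overline{W} - \tau\varepsilon_1$ and $W_H = (W_2 - W_1, \ldots, W_n - W_1)'$. Then the conditional distribution of $W_b$ given $W_H = h$, where $h$ corresponds to observed data via $h_i = x_{i+1} - x_1$, is normal with mean $\frac{\tau^2}{1+\tau^2}(\bar{x} - x_1)$ and variance $\frac{n\tau^2+1}{n(\tau^2+1)}$. -/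

import Mathlib

open MeasureTheory ProbabilityTheory

/-- If `R` is independent of `X`, then the conditional distribution of `R + f ∘ X` given `X = x` is
the law of `R` translated by `f x`. -/
theorem condDistrib_add_comp_of_indepFun {Ω β : Type*} [MeasurableSpace Ω] [MeasurableSpace β]
    {P : Measure Ω} [IsProbabilityMeasure P] {X : Ω → β} {R : Ω → ℝ} {f : β → ℝ}
    (hX : AEMeasurable X P) (hR : AEMeasurable R P) (hf : Measurable f) (h : IndepFun X R P) :
    ∀ᵐ x ∂(P.map X),
      condDistrib (fun ω => R ω + f (X ω)) X P x = (P.map R).map (fun r => r + f x) := by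
  have hprobR : IsProbabilityMeasure (P.map R) := Measure.isProbabilityMeasure_map hR
  have hg : Measurable fun p : β × ℝ => p.2 + f p.1 := by fun_prop
  let κ : Kernel β ℝ := (Kernel.id ×ₖ Kernel.const β (P.map R)).map fun p => p.2 + f p.1
  have hκ : IsMarkovKernel κ := Kernel.IsMarkovKernel.map _ hg
  have hκ_apply (x : β) : κ x = (P.map R).map (fun r => r + f x) := by
    rw [Kernel.map_apply _ hg, Kernel.prod_apply, Kernel.id_apply, Kernel.const_apply,
      Measure.dirac_prod, Measure.map_map hg (by fun_prop)]
    rfl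
  have key : P.map (fun ω => (X ω, R ω + f (X ω))) = P.map X ⊗ₘ κ := by
    have hmap : P.map (fun ω => (X ω, R ω + f (X ω))) =
        ((P.map X).prod (P.map R)).map fun p : β × ℝ => (p.1, p.2 + f p.1) := by
      rw [← (indepFun_iff_map_prod_eq_prod_map_map hX hR).1 h,
        AEMeasurable.map_map_of_aemeasurable (by fun_prop) (hX.prodMk hR)]
      rfl
    rw [hmap]
    refine Measure.ext_of_lintegral _ fun g hgm => ?_
    have hgf : Measurable fun p : β × ℝ => g (p.1, p.2 + f p.1) := by fun_prop
    rw [lintegral_map hgm (by fun_prop), lintegral_prod _ hgf.aemeasurable,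
      Measure.lintegral_compProd hgm]
    refine lintegral_congr fun x => ?_
    rw [hκ_apply]
    exact (lintegral_map (f := fun y => g (x, y)) (by fun_prop) (by fun_prop)).symm
  filter_upwards [condDistrib_ae_eq_of_measure_eq_compProd X
    (hR.add (hf.comp_aemeasurable hX)) key] with x hx
  rw [← hκ_apply, ← hx]
  rfl

/-- The covariance of two linear combinations of independent standard Gaussian variables is the
dot product of their coefficients. -/
theorem covariance_sum_mul_of_iIndepFun_gaussianReal {Ω ι : Type*} [MeasurableSpace Ω] [Fintype ι]
    {P : Measure Ω} [IsProbabilityMeasure P] {X : ι → Ω → ℝ}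
    (hX : ∀ i, HasLaw (X i) (gaussianReal 0 1) P) (hindep : iIndepFun X P) (a b : ι → ℝ) :
    cov[fun ω => ∑ i, a i * X i ω, fun ω => ∑ i, b i * X i ω; P] = ∑ i, a i * b i := by
  classical
  have hL (i : ι) : MemLp (X i) 2 P := (hX i).hasGaussianLaw.memLp_two
  rw [covariance_fun_sum_fun_sum (fun i => (hL i).const_mul _) (fun i => (hL i).const_mul _)]
  refine Finset.sum_congr rfl fun i _ => ?_
  rw [Finset.sum_eq_single i]
  · rw [covariance_const_mul_left, covariance_const_mul_right, covariance_self (hL i).aemeasurable,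
      (hX i).variance_eq, variance_id_gaussianReal]
    simp
  · intro j _ hj
    rw [covariance_const_mul_left, covariance_const_mul_right,
      (hindep.indepFun hj.symm).covariance_eq_zero (hL i) (hL j)]
    simp
  · simp

/-- Gaussian conditioning for linear functionals of independent standard Gaussian variables: if the
coefficient vector `r` is orthogonal to all rows of `A`, then `r ⬝ X + c ⬝ (A X)` given `A X = h` is
Gaussian with mean `c ⬝ h` and variance `r ⬝ r`. -/
theorem condDistrib_sum_mul_of_iIndepFun_gaussianReal {Ω ι κ : Type*} [MeasurableSpace Ω]
    [Fintype ι] [Fintype κ] {P : Measure Ω} [IsProbabilityMeasure P] {X : ι → Ω → ℝ}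
    (hX : ∀ i, HasLaw (X i) (gaussianReal 0 1) P) (hindep : iIndepFun X P)
    (r : ι → ℝ) (A : κ → ι → ℝ) (c : κ → ℝ) (hrA : ∀ j, ∑ i, A j i * r i = 0) :
    ∀ᵐ h ∂(P.map fun ω j => ∑ i, A j i * X i ω),
      condDistrib (fun ω => ∑ i, r i * X i ω + ∑ j, c j * ∑ i, A j i * X i ω)
        (fun ω j => ∑ i, A j i * X i ω) P h =
        gaussianReal (∑ j, c j * h j) (∑ i, r i * r i).toNNReal := by
  have hXg : HasGaussianLaw (fun ω i => X i ω) P :=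
    iIndepFun.hasGaussianLaw (fun i => (hX i).hasGaussianLaw) hindep
  let L (a : ι → ℝ) : (ι → ℝ) →L[ℝ] ℝ := ∑ i, a i • ContinuousLinearMap.proj i
  have hL (a : ι → ℝ) (x : ι → ℝ) : L a x = ∑ i, a i * x i := by simp [L]
  have hjoint : HasGaussianLaw
      (fun ω => (fun j => ∑ i, A j i * X i ω, fun _ : Unit => ∑ i, r i * X i ω)) P := by
    simpa [hL, ContinuousLinearMap.pi_apply] using
      hXg.map_fun ((ContinuousLinearMap.pi fun j => L (A j)).prod
        (ContinuousLinearMap.pi fun _ : Unit => L r))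
  have hR : HasGaussianLaw (fun ω => ∑ i, r i * X i ω) P := by
    simpa only [hL] using hXg.map_fun (L r)
  have hmean : P[fun ω => ∑ i, r i * X i ω] = 0 := by
    rw [integral_finsetSum _ fun i _ => ((hX i).hasGaussianLaw.integrable.const_mul _)]
    refine Finset.sum_eq_zero fun i _ => ?_
    rw [integral_const_mul, (hX i).integral_eq, integral_id_gaussianReal, mul_zero]
  have hind : IndepFun (fun ω j => ∑ i, A j i * X i ω) (fun ω => ∑ i, r i * X i ω) P := by
    have := hjoint.indepFun_of_covariance_eval (X := fun j ω => ∑ i, A j i * X i ω)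
      (Y := fun _ ω => ∑ i, r i * X i ω) fun j _ => by
        rw [covariance_sum_mul_of_iIndepFun_gaussianReal hX hindep, hrA]
    exact this.comp measurable_id (measurable_pi_apply ())
  filter_upwards [condDistrib_add_comp_of_indepFun (f := fun h => ∑ j, c j * h j)
    hjoint.fst.aemeasurable hR.aemeasurable (by fun_prop) hind] with h hh
  rw [hh, hR.map_eq_gaussianReal, hmean, ← covariance_self hR.aemeasurable,
    covariance_sum_mul_of_iIndepFun_gaussianReal hX hindep, gaussianReal_map_add_const, zero_add]

/-- Let `Wᵢ = τεᵢ + eᵢ` with `εᵢ, eᵢ` independent standard normals (so `Wᵢ` i.i.d.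
`N(0, 1+τ²)`), `W_b = W̄ - τε₁` and `W_H = (W₂ - W₁, …, W_n - W₁)`. Then the conditional
distribution of `W_b` given `W_H = h` (where `hᵢ = x_{i+1} - x₁`, so `x̄ - x₁ = (∑ hᵢ)/n`)
is `N((τ²/(1+τ²)) (x̄ - x₁), (nτ²+1)/(n(τ²+1)))`. -/
theorem stmt_0 {Ω : Type*} [MeasurableSpace Ω] (P : Measure Ω) [IsProbabilityMeasure P]
    (n : ℕ) (hn : 2 ≤ n) (τ : ℝ) (hτ : 0 < τ)
    (ε e : Ω → Fin n → ℝ)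
    (hlaw : Measure.map (fun ω => (ε ω, e ω)) P =
      (Measure.pi fun _ : Fin n => gaussianReal 0 1).prod
        (Measure.pi fun _ : Fin n => gaussianReal 0 1))
    (W : Ω → Fin n → ℝ) (hW : ∀ ω i, W ω i = τ * ε ω i + e ω i)
    (Wb : Ω → ℝ) (hWb : ∀ ω, Wb ω = (∑ i, W ω i) / n - τ * ε ω ⟨0, by omega⟩)
    (WH : Ω → Fin (n - 1) → ℝ)
    (hWH : ∀ ω j, WH ω j = W ω ⟨j.1 + 1, by omega⟩ - W ω ⟨0, by omega⟩) :
    ∀ᵐ h ∂(Measure.map WH P),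
      condDistrib Wb WH P h =
        gaussianReal ((τ ^ 2 / (1 + τ ^ 2)) * ((∑ j, h j) / n))
          (((n * τ ^ 2 + 1) / (n * (τ ^ 2 + 1))).toNNReal) := by
  obtain ⟨m, rfl⟩ : ∃ m, n = m + 1 := ⟨n - 1, by omega⟩
  have hZm : AEMeasurable (fun ω => (ε ω, e ω)) P := by
    by_contra hc
    rw [Measure.map_of_not_aemeasurable hc] at hlaw
    exact (IsProbabilityMeasure.ne_zero _) hlaw.symm
  let X (k : Fin (m + 1) ⊕ Fin (m + 1)) (ω : Ω) : ℝ := Sum.elim (ε ω) (e ω) k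
  have hXlaw : HasLaw (fun ω k => X k ω) (Measure.pi fun _ => gaussianReal 0 1) P := by
    have hmp := (measurePreserving_sumPiEquivProdPi_symm
      fun _ : Fin (m + 1) ⊕ Fin (m + 1) => gaussianReal 0 1)
    have hcomp : (fun ω k => X k ω) = (MeasurableEquiv.sumPiEquivProdPi
        fun _ : Fin (m + 1) ⊕ Fin (m + 1) => ℝ).symm ∘ fun ω => (ε ω, e ω) := by
      ext ω k
      cases k <;> rfl
    refine ⟨hcomp ▸ hmp.measurable.comp_aemeasurable hZm, ?_⟩
    rw [hcomp, ← AEMeasurable.map_map_of_aemeasurable hmp.measurable.aemeasurable hZm, hlaw]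
    exact hmp.map_eq
  have hX (k) : HasLaw (X k) (gaussianReal 0 1) P :=
    (measurePreserving_eval (fun _ => gaussianReal 0 1) k).hasLaw.comp hXlaw
  have hindep : iIndepFun X P := by
    rw [iIndepFun_iff_map_fun_eq_pi_map fun k => (hX k).aemeasurable, hXlaw.map_eq]
    simp_rw [(hX _).map_eq]
  set s : ℝ := τ ^ 2 / (1 + τ ^ 2) with hs
  have hsτ : τ ^ 2 * (1 - s) = s := by
    rw [hs]
    field_simp
    ring
  let A (j : Fin m) : Fin (m + 1) ⊕ Fin (m + 1) → ℝ :=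
    Sum.elim (fun i => τ * ((if i = j.succ then 1 else 0) - if i = 0 then 1 else 0))
      (fun i => (if i = j.succ then 1 else 0) - if i = 0 then 1 else 0)
  let r : Fin (m + 1) ⊕ Fin (m + 1) → ℝ :=
    Sum.elim (fun i => (1 - s) * τ / (m + 1) + if i = 0 then s * τ - τ else 0)
      (fun i => (1 - s) / (m + 1) + if i = 0 then s else 0)
  have hA : WH = fun ω (j : Fin m) => ∑ k, A j k * X k ω := by
    ext ω j
    rw [hWH]
    simp only [hW, A, X, Fintype.sum_sum_type, Sum.elim_inl, Sum.elim_inr, mul_sub, sub_mul,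
      Finset.sum_sub_distrib, mul_ite, ite_mul, mul_one, mul_zero, one_mul, zero_mul,
      Finset.sum_ite_eq', Finset.mem_univ, if_true]
    change τ * ε ω j.succ + e ω j.succ - (τ * ε ω 0 + e ω 0) = _
    ring
  have hrA (j : Fin m) : ∑ k, A j k * r k = 0 := by
    simp [A, r, Fintype.sum_sum_type, mul_sub, sub_mul, Finset.sum_sub_distrib]
    linear_combination hsτ
  have hrr : ∑ k, r k * r k =
      (((m + 1 : ℕ) : ℝ) * τ ^ 2 + 1) / (((m + 1 : ℕ) : ℝ) * (τ ^ 2 + 1)) := by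
    simp [r, Fintype.sum_sum_type, mul_add, add_mul, Finset.sum_add_distrib]
    rw [show (m : ℝ) * τ ^ 2 + τ ^ 2 + (m + 1) = (m + 1) * (1 + τ ^ 2) by ring, hs]
    field_simp
    ring
  have hY : Wb = fun ω => ∑ k, r k * X k ω + ∑ j : Fin m, s / (m + 1) * ∑ k, A j k * X k ω := by
    ext ω
    have hAω (j : Fin m) : ∑ k, A j k * X k ω = WH ω j := by rw [hA]
    have hWr : ∑ k, r k * X k ω =
        (1 - s) / (m + 1) * ∑ i, W ω i + s * W ω 0 - τ * ε ω 0 := by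
      simp only [hW, r, X, Fintype.sum_sum_type, Sum.elim_inl, Sum.elim_inr, add_mul, ite_mul,
        zero_mul, Finset.sum_add_distrib, Finset.sum_ite_eq', Finset.mem_univ, if_true,
        ← Finset.mul_sum]
      ring
    have hWH_sum : ∑ j : Fin m, WH ω j = ∑ i, W ω i - (m + 1) * W ω 0 := by
      have hj (j : Fin m) : WH ω j = W ω j.succ - W ω 0 := hWH ω j
      simp only [hj, Finset.sum_sub_distrib, Fin.sum_univ_succ (W ω), Finset.sum_const,
        Finset.card_univ, Fintype.card_fin, nsmul_eq_mul]
      ring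
    simp_rw [hAω]
    rw [← Finset.mul_sum, hWr, hWH_sum, hWb, Nat.cast_add_one, Fin.mk_zero']
    field_simp
    ring
  have main := condDistrib_sum_mul_of_iIndepFun_gaussianReal hX hindep r A (fun _ => s / (m + 1)) hrA
  rw [← hA, ← hY, hrr] at main
  filter_upwards [main] with h hh
  rw [hh, ← Finset.mul_sum]
  congr 1
  rw [Nat.cast_add_one, div_mul_eq_mul_div, mul_div_assoc]
  rfl
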